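/- Every finite hypergraphic preference system has a fractional stable matching. -/

import Mathlib

open Finset in
/-- A mod 2 cycle and a mod 2 cocycle of the full simplex on `ι` meet in an even number of
simplices; the proof cones the cycle off from `x₀`. -/
theorem Finset.even_card_inter_of_cycle_of_cocycle {ι : Type*} [Fintype ι] [DecidableEq ι]
    {n : ℕ} {D F : Finset (Finset ι)} (x₀ : ι)
    (hD : ∀ J ∈ D, #J = n) (hF : ∀ J ∈ F, #J = n)
    (hcycle : ∀ K : Finset ι, #K + 1 = n → Even #{j | j ∉ K ∧ insert j K ∈ D})
    (hcocycle : ∀ S : Finset ι, #S = n + 1 → Even #{k ∈ S | S.erase k ∈ F}) :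
    Even #(D ∩ F) := by
  have hA : Even (∑ J ∈ D with x₀ ∉ J, #{k ∈ insert x₀ J | (insert x₀ J).erase k ∈ F}) := by
    refine Finset.even_sum _ fun J hJ => ?_
    rw [mem_filter] at hJ
    exact hcocycle _ (by rw [card_insert_of_notMem hJ.2, hD J hJ.1])
  have hB : Even (∑ J ∈ F with x₀ ∈ J,
      #{j | j ∉ J.erase x₀ ∧ insert j (J.erase x₀) ∈ D}) := by
    refine Finset.even_sum _ fun J hJ => ?_
    rw [mem_filter] at hJ
    exact hcycle _ (by rw [card_erase_add_one hJ.2, hF J hJ.1])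
  have hA' : ∑ J ∈ D with x₀ ∉ J, #{k ∈ insert x₀ J | (insert x₀ J).erase k ∈ F} =
      #{J ∈ D ∩ F | x₀ ∉ J} +
        ∑ J ∈ D with x₀ ∉ J, #{k ∈ J | (insert x₀ J).erase k ∈ F} := by
    have : #{J ∈ D ∩ F | x₀ ∉ J} = ∑ J ∈ D with x₀ ∉ J, if J ∈ F then 1 else 0 := by
      rw [← card_filter, filter_filter]
      congr 1
      ext J
      simp only [mem_filter, mem_inter]
      tauto
    rw [this, ← sum_add_distrib]
    refine sum_congr rfl fun J hJ => ?_
    rw [mem_filter] at hJ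
    rw [filter_insert, erase_insert hJ.2]
    split_ifs with h
    · rw [card_insert_of_notMem (by simp [hJ.2]), add_comm]
    · simp
  have hB' : ∑ J ∈ F with x₀ ∈ J, #{j | j ∉ J.erase x₀ ∧ insert j (J.erase x₀) ∈ D} =
      #{J ∈ D ∩ F | x₀ ∈ J} +
        ∑ J ∈ F with x₀ ∈ J, #{j | j ∉ J ∧ insert j (J.erase x₀) ∈ D} := by
    have : #{J ∈ D ∩ F | x₀ ∈ J} = ∑ J ∈ F with x₀ ∈ J, if J ∈ D then 1 else 0 := by
      rw [← card_filter, filter_filter]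
      congr 1
      ext J
      simp only [mem_filter, mem_inter]
      tauto
    rw [this, ← sum_add_distrib]
    refine sum_congr rfl fun J hJ => ?_
    rw [mem_filter] at hJ
    have hsplit : ({j | j ∉ J.erase x₀ ∧ insert j (J.erase x₀) ∈ D} : Finset ι) =
        ({j | j ∉ J ∧ insert j (J.erase x₀) ∈ D} : Finset ι) ∪ if J ∈ D then {x₀} else ∅ := by
      ext j
      by_cases hj : j = x₀
      · subst hj
        by_cases hJD : J ∈ D <;> simp [hJD, hJ.2]
      · by_cases hJD : J ∈ D <;> simp [hJD, hj]
    rw [hsplit, card_union_of_disjoint, add_comm]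
    · split_ifs <;> simp
    · split_ifs <;> simp [hJ.2]
  have hT : ∑ J ∈ D with x₀ ∉ J, #{k ∈ J | (insert x₀ J).erase k ∈ F} =
      ∑ J ∈ F with x₀ ∈ J, #{j | j ∉ J ∧ insert j (J.erase x₀) ∈ D} := by
    rw [← card_sigma, ← card_sigma]
    refine card_nbij' (fun p => ⟨(insert x₀ p.1).erase p.2, p.2⟩)
      (fun p => ⟨insert p.2 (p.1.erase x₀), p.2⟩) ?_ ?_ ?_ ?_
    · rintro ⟨J, k⟩ h
      simp only [coe_sigma, Set.mem_sigma_iff, mem_coe, mem_filter, mem_univ, true_and] at h ⊢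
      obtain ⟨⟨h1, h2⟩, h3, h4⟩ := h
      have hne : x₀ ≠ k := by rintro rfl; exact h2 h3
      refine ⟨⟨h4, by simp [hne]⟩, by simp, ?_⟩
      rwa [erase_right_comm, erase_insert h2, insert_erase h3]
    · rintro ⟨J, k⟩ h
      simp only [coe_sigma, Set.mem_sigma_iff, mem_coe, mem_filter, mem_univ, true_and] at h ⊢
      obtain ⟨⟨h1, h2⟩, h3, h4⟩ := h
      have hne : x₀ ≠ k := by rintro rfl; exact h3 h2
      refine ⟨⟨h4, by simp [hne]⟩, by simp, ?_⟩
      rwa [insert_comm, insert_erase h2, erase_insert h3]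
    · rintro ⟨J, k⟩ h
      simp only [coe_sigma, Set.mem_sigma_iff, mem_coe, mem_filter] at h ⊢
      obtain ⟨⟨h1, h2⟩, h3, h4⟩ := h
      rw [erase_right_comm, erase_insert h2, insert_erase h3]
    · rintro ⟨J, k⟩ h
      simp only [coe_sigma, Set.mem_sigma_iff, mem_coe, mem_filter, mem_univ, true_and] at h ⊢
      obtain ⟨⟨h1, h2⟩, h3, h4⟩ := h
      rw [insert_comm, insert_erase h2, erase_insert h3]
  have hcard := card_filter_add_card_filter_not (s := D ∩ F) (fun J => x₀ ∈ J)
  rw [hA'] at hA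
  rw [hB', ← hT] at hB
  rw [← hcard]
  rw [Nat.even_iff] at *
  omega

namespace Scarf

open Finset

section Ordinal

variable {R ι α : Type*} [LinearOrder α]

/-- A set `J` of columns is dominating for the utilities `c` if every column is, in some row,
at most all the columns of `J`. -/
def Dominating (c : R → ι → α) (J : Finset ι) : Prop :=
  ∀ k, ∃ v, ∀ j ∈ J, c v k ≤ c v j

theorem Dominating.mono {c : R → ι → α} {J K : Finset ι} (hJ : Dominating c J) (h : K ⊆ J) :
    Dominating c K := fun k =>
  let ⟨v, hv⟩ := hJ k
  ⟨v, fun j hj => hv j (h hj)⟩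

variable [Fintype R] [Fintype ι] [DecidableEq ι]

open Classical in
/-- A set of `card R - 1` columns lies in zero or two dominating sets of size `card R`, unless it
is on the boundary. -/
theorem even_card_dominating_insert {c : R → ι → α} (hc : ∀ v, Function.Injective (c v))
    {K : Finset ι} (hcard : #K + 1 = Fintype.card R) (hne : K.Nonempty)
    (hint : ∀ u, ∃ k, ∀ v ≠ u, ∃ i ∈ K, c v i < c v k) :
    Even #{j | j ∉ K ∧ Dominating c (insert j K)} := by
  by_cases hK : Dominating c K
  swap
  · rw [filter_false_of_mem fun j _ h => hK (h.2.mono (subset_insert _ _))]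
    simp
  choose m hmK hm using fun v => K.exists_min_image (c v) hne
  have hsurj : ∀ k ∈ K, ∃ v, m v = k := fun k hk => by
    obtain ⟨v, hv⟩ := hK k
    exact ⟨v, hc v (le_antisymm (hm v k hk) (hv _ (hmK v)))⟩
  obtain ⟨u₁, -, u₂, -, hu, hmu⟩ :=
    exists_ne_map_eq_of_card_lt_of_maps_to (s := (univ : Finset R)) (t := K) (f := m)
      (by rw [card_univ]; omega) (fun v _ => hmK v)
  have hsurj_of : ∀ u u', u ≠ u' → m u = m u' → ∀ k ∈ K, ∃ v, v ≠ u ∧ m v = k := by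
    intro u u' huu' h k hk
    obtain ⟨v, rfl⟩ := hsurj k hk
    by_cases hv : v = u
    · exact ⟨u', huu'.symm, by rw [hv, h]⟩
    · exact ⟨v, hv, rfl⟩
  have hinj_of : ∀ u, (∀ k ∈ K, ∃ v, v ≠ u ∧ m v = k) →
      ∀ v w, v ≠ u → w ≠ u → m v = m w → v = w := by
    intro u hs v w hv hw h
    have himg : (univ.erase u).image m = K := by
      ext k
      simp only [mem_image, mem_erase, mem_univ, and_true]
      exact ⟨by rintro ⟨v, -, rfl⟩; exact hmK v, hs k⟩
    have : Set.InjOn m (univ.erase u : Finset R) := by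
      apply injOn_of_card_image_eq
      rw [himg, card_erase_of_mem (mem_univ _), card_univ]
      omega
    exact this (by simpa using hv) (by simpa using hw) h
  have hs₁ := hsurj_of u₁ u₂ hu hmu
  have hs₂ := hsurj_of u₂ u₁ hu.symm hmu.symm
  have hi₁ := hinj_of u₁ hs₁
  have hi₂ := hinj_of u₂ hs₂
  let A : R → Finset ι := fun u => {k | ∀ v ≠ u, c v (m v) < c v k}
  have memA : ∀ {u k}, k ∈ A u ↔ ∀ v ≠ u, c v (m v) < c v k := by simp [A]
  have hAne : ∀ u, (A u).Nonempty := fun u => by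
    obtain ⟨k, hk⟩ := hint u
    refine ⟨k, memA.2 fun v hv => ?_⟩
    obtain ⟨i, hi, hik⟩ := hk v hv
    exact (hm v i hi).trans_lt hik
  choose g hgA hg using fun u => (A u).exists_max_image (c u) (hAne u)
  have hgdom : ∀ u, (∀ k ∈ K, ∃ v, v ≠ u ∧ m v = k) →
      g u ∉ K ∧ Dominating c (insert (g u) K) := by
    intro u hs
    refine ⟨fun h => ?_, fun k => ?_⟩
    · obtain ⟨v, hv, hmv⟩ := hs _ h
      exact absurd (memA.1 (hgA u) v hv) (by rw [hmv]; exact lt_irrefl _)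
    · by_cases hk : k ∈ A u
      · refine ⟨u, ?_⟩
        obtain ⟨v, hv⟩ := hK k
        obtain rfl : v = u := by
          by_contra hvu
          exact (memA.1 hk v hvu).not_ge (hv _ (hmK v))
        simpa using ⟨hg v k hk, hv⟩
      · rw [memA] at hk
        push Not at hk
        obtain ⟨v, hv, hk⟩ := hk
        refine ⟨v, ?_⟩
        simpa using ⟨hk.trans (memA.1 (hgA u) v hv).le, fun j hj => hk.trans (hm v j hj)⟩
  have hunique : ∀ u j, (∀ v w, v ≠ u → w ≠ u → m v = m w → v = w) → j ∉ K →
      Dominating c (insert j K) → (∀ i ∈ insert j K, c u j ≤ c u i) → j = g u := by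
    intro u j hi hj hdom hju
    have hjA : j ∈ A u := by
      refine memA.2 fun v hv => ?_
      obtain ⟨w, hw⟩ := hdom (m v)
      have hlt : c w (m v) < c w j := by
        refine lt_of_le_of_ne (hw j (mem_insert_self _ _)) fun h => hj ?_
        rw [← hc w h]
        exact hmK v
      have hwu : w ≠ u := by
        rintro rfl
        exact hlt.not_ge (hju _ (mem_insert_of_mem (hmK v)))
      have hmw : m w = m v :=
        hc w (le_antisymm (hm w _ (hmK v)) (hw _ (mem_insert_of_mem (hmK w))))
      rw [hi w v hwu hv hmw] at hlt
      exact hlt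
    refine hc u (le_antisymm (hg u j hjA) ?_)
    obtain ⟨v, hv⟩ := hdom (g u)
    by_cases hvu : v = u
    · subst hvu
      exact hv j (mem_insert_self _ _)
    · exact absurd (hv _ (mem_insert_of_mem (hmK v))) (memA.1 (hgA u) v hvu).not_ge
  have hgne : g u₁ ≠ g u₂ := by
    intro h
    obtain ⟨v, hv⟩ := hK (g u₁)
    by_cases hv₁ : v = u₁
    · have := memA.1 (hgA u₂) v (by rw [hv₁]; exact hu)
      rw [← h] at this
      exact this.not_ge (hv _ (hmK v))
    · exact (memA.1 (hgA u₁) v hv₁).not_ge (hv _ (hmK v))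
  have : ({j | j ∉ K ∧ Dominating c (insert j K)} : Finset ι) = {g u₁, g u₂} := by
    ext j
    simp only [mem_filter, mem_univ, true_and, mem_insert, mem_singleton]
    constructor
    · rintro ⟨hj, hdom⟩
      obtain ⟨u, hju⟩ := hdom j
      by_cases h₁ : u = u₁
      · subst h₁
        exact Or.inl (hunique u j hi₁ hj hdom hju)
      by_cases h₂ : u = u₂
      · subst h₂
        exact Or.inr (hunique u j hi₂ hj hdom hju)
      exfalso
      obtain ⟨w, hw⟩ := hdom (m u)
      have hmw : m w = m u :=
        hc w (le_antisymm (hm w _ (hmK u)) (hw _ (mem_insert_of_mem (hmK w))))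
      have hwu : w ≠ u := by
        rintro rfl
        have h := le_antisymm (hw j (mem_insert_self _ _)) (hju _ (mem_insert_of_mem (hmK w)))
        exact hj (hc w h ▸ hmK w)
      have hw₁ : w = u₁ := by
        by_contra h
        exact hwu (hi₁ w u h h₁ hmw)
      have hw₂ : w = u₂ := by
        by_contra h
        exact hwu (hi₂ w u h h₂ hmw)
      exact hu (hw₁.symm.trans hw₂)
    · rintro (rfl | rfl)
      · exact hgdom u₁ hs₁
      · exact hgdom u₂ hs₂
  rw [this, card_pair hgne]
  exact even_two

end Ordinal

section SlackColumns

variable {R N α : Type*} [Fintype R] [DecidableEq R] [Fintype N] [DecidableEq N] [Nonempty N]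
  [LinearOrder α]

/-- The set of slack columns. -/
def slackSet (R N : Type*) [Fintype R] [DecidableEq R] [DecidableEq N] : Finset (R ⊕ N) :=
  univ.image Sum.inl

open Classical in
/-- The dominating sets of size `card R`, together with the set of slack columns, form a
mod 2 cycle. -/
theorem even_card_insert_dominating_or_slackSet {c : R → R ⊕ N → α}
    (hc : ∀ v, Function.Injective (c v))
    (hmin : ∀ v e, c v (Sum.inl v) < c v (Sum.inr e))
    (hmax : ∀ v u e, u ≠ v → c v (Sum.inr e) < c v (Sum.inl u))
    {K : Finset (R ⊕ N)} (hcard : #K + 1 = Fintype.card R) :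
    Even #{j | j ∉ K ∧ (Dominating c (insert j K) ∨ insert j K = slackSet R N)} := by
  by_cases hK : ∃ e, Sum.inr e ∈ K
  · obtain ⟨e, he⟩ := hK
    have hslack : ∀ j, insert j K ≠ slackSet R N := fun j h => by
      have : Sum.inr e ∈ slackSet R N := h ▸ mem_insert_of_mem he
      simp [slackSet] at this
    simp only [hslack, or_false]
    exact even_card_dominating_insert hc hcard ⟨_, he⟩
      fun u => ⟨Sum.inl u, fun v hv => ⟨_, he, hmax v u e hv.symm⟩⟩
  · push Not at hK
    obtain ⟨i, hi⟩ : ∃ i, Sum.inl i ∉ K := by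
      by_contra! h
      have hle : #(slackSet R N) ≤ #K := card_le_card fun j hj => by
        obtain ⟨u, -, rfl⟩ := mem_image.1 hj
        exact h u
      rw [slackSet, card_image_of_injective _ Sum.inl_injective, card_univ] at hle
      omega
    have hKeq : K = (univ.erase i).image Sum.inl := by
      refine eq_of_subset_of_card_le (fun j hj => ?_) ?_
      · rcases j with u | e
        · simp only [mem_image, mem_erase, mem_univ, and_true]
          exact ⟨u, by rintro rfl; exact hi hj, rfl⟩
        · exact absurd hj (hK e)
      · rw [card_image_of_injective _ Sum.inl_injective, card_erase_of_mem (mem_univ _),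
          card_univ]
        omega
    have hmemK : ∀ u, Sum.inl u ∈ K ↔ u ≠ i := by simp [hKeq]
    obtain ⟨e, he⟩ := Finite.exists_max (fun e : N => c i (Sum.inr e))
    have hslack_le : ∀ u j, c u (Sum.inl u) ≤ c u j := by
      rintro u (v | f)
      · by_cases h : v = u
        · rw [h]
        · exact ((hmin u e).trans (hmax u v e h)).le
      · exact (hmin u f).le
    have : ({j | j ∉ K ∧ (Dominating c (insert j K) ∨ insert j K = slackSet R N)} :
        Finset (R ⊕ N)) = {Sum.inl i, Sum.inr e} := by
      ext j
      simp only [mem_filter, mem_univ, true_and, mem_insert, mem_singleton]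
      constructor
      · rintro ⟨hj, hdom⟩
        rcases j with u | f
        · rw [hmemK, not_not] at hj
          exact Or.inl (congrArg _ hj)
        · right
          rcases hdom with hdom | hdom
          · obtain ⟨v, hv⟩ := hdom (Sum.inr e)
            by_cases hvi : v = i
            · subst hvi
              exact hc v (le_antisymm (he f) (hv _ (mem_insert_self _ _)))
            · exact absurd (hv _ (mem_insert_of_mem ((hmemK v).2 hvi))) (hmin v e).not_ge
          · have : Sum.inr f ∈ slackSet R N := hdom ▸ mem_insert_self _ _
            simp [slackSet] at this
      · rintro (rfl | rfl)
        · refine ⟨hi, Or.inr ?_⟩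
          rw [hKeq, ← image_insert, insert_erase (mem_univ i), slackSet]
        · refine ⟨hK e, Or.inl ?_⟩
          rintro (u | f)
          · exact ⟨u, fun j _ => hslack_le u j⟩
          · refine ⟨i, fun j hj => ?_⟩
            rcases mem_insert.1 hj with rfl | hj
            · exact he f
            · rcases j with u | f'
              · exact (hmax i u f ((hmemK u).1 hj)).le
              · exact absurd hj (hK f')
    rw [this, card_pair (by simp)]
    exact even_two

end SlackColumns

section Feasible

variable {R ι : Type*} [Fintype R] [Fintype ι]

/-- A set `J` of columns is feasible if `L x = b` has a nonnegative solution supported in `J`. -/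
def Feasible (L : (ι → ℝ) →ₗ[ℝ] R → ℝ) (b : R → ℝ) (J : Finset ι) : Prop :=
  ∃ x, 0 ≤ x ∧ (∀ i ∉ J, x i = 0) ∧ L x = b

theorem exists_mem_ker_of_card_lt (L : (ι → ℝ) →ₗ[ℝ] R → ℝ) {S : Finset ι}
    (hS : Fintype.card R < #S) : ∃ z, L z = 0 ∧ z ≠ 0 ∧ ∀ i ∉ S, z i = 0 := by
  let M := Function.ExtendByZero.linearMap ℝ (Subtype.val : S → ι)
  have hker : LinearMap.ker (L ∘ₗ M) ≠ ⊥ :=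
    LinearMap.ker_ne_bot_of_finrank_lt (by simpa using hS)
  obtain ⟨y, hy, hy0⟩ := Submodule.exists_mem_ne_zero_of_ne_bot hker
  refine ⟨M y, hy, fun h => hy0 ?_, fun i hi => ?_⟩
  · ext s
    have := congrFun h s
    simpa [M, Subtype.val_injective.extend_apply] using this
  · simp only [M, Function.ExtendByZero.linearMap_apply]
    rw [Function.extend_apply' _ _ _ (by rintro ⟨s, rfl⟩; exact hi s.2)]
    rfl

variable [DecidableEq ι]

open Classical in
/-- For nondegenerate `b`, the feasible sets of size `card R` form a mod 2 cocycle. -/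
theorem even_card_feasible_erase {L : (ι → ℝ) →ₗ[ℝ] R → ℝ} {b : R → ℝ}
    (hker : ∀ z, 0 ≤ z → L z = 0 → z = 0)
    (hgen : ∀ x, L x = b → Fintype.card R ≤ #{i | x i ≠ 0})
    {S : Finset ι} (hS : #S = Fintype.card R + 1) :
    Even #{k ∈ S | Feasible L b (S.erase k)} := by
  rcases ({k ∈ S | Feasible L b (S.erase k)} : Finset ι).eq_empty_or_nonempty with h | ⟨s, hs⟩
  · simp [h]
  rw [mem_filter] at hs
  obtain ⟨hsS, x, hx0, hxs, hx⟩ := hs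
  have hne : ∀ k ∈ S, ∀ y, L y = b → (∀ i ∉ S.erase k, y i = 0) → ∀ i ∈ S.erase k, y i ≠ 0 := by
    intro k hk y hy hyk i hi
    have hsub : ({i | y i ≠ 0} : Finset ι) ⊆ S.erase k := fun i hi => by
      by_contra h
      exact (mem_filter.1 hi).2 (hyk i h)
    have heq := eq_of_subset_of_card_le hsub
      ((by rw [card_erase_of_mem hk]; omega : #(S.erase k) ≤ Fintype.card R).trans (hgen y hy))
    rw [← heq] at hi
    exact (mem_filter.1 hi).2
  have hzero : ∀ y, L y = 0 → (∀ i ∉ S.erase s, y i = 0) → y = 0 := by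
    intro y hy hys
    by_contra hy0
    obtain ⟨i, hi⟩ := Function.ne_iff.1 hy0
    have hiS : i ∈ S.erase s := by
      by_contra h
      exact hi (hys i h)
    refine hne s hsS (x - (x i / y i) • y) (by simp [hx, hy]) (fun j hj => ?_) i hiS ?_
    · simp [hxs j hj, hys j hj]
    · have : y i ≠ 0 := hi
      simp [this]
  obtain ⟨z, hz, hzs, hzS⟩ : ∃ z, L z = 0 ∧ z s = 1 ∧ ∀ i ∉ S, z i = 0 := by
    obtain ⟨z, hz, hz0, hzS⟩ := exists_mem_ker_of_card_lt L (S := S) (by omega)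
    have hzs : z s ≠ 0 := fun h => hz0 <| hzero z hz fun i hi => by
      by_cases his : i = s
      · rw [his, h]
      · exact hzS i fun hiS => hi (mem_erase.2 ⟨his, hiS⟩)
    refine ⟨(z s)⁻¹ • z, by simp [hz], by simp [hzs], fun i hi => by simp [hzS i hi]⟩
  have hline : ∀ y, L y = b → (∀ i ∉ S, y i = 0) → ∀ i, y i = x i + y s * z i := by
    intro y hy hyS
    have hxs0 : x s = 0 := hxs s (by simp)
    have := hzero (y - x - y s • z) (by simp [hx, hy, hz]) fun i hi => by
      by_cases his : i = s
      · simp [his, hzs, hxs0]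
      · have hiS : i ∉ S := fun hiS => hi (mem_erase.2 ⟨his, hiS⟩)
        simp [hyS i hiS, hxs i hi, hzS i hiS]
    intro i
    have := congrFun this i
    simp only [Pi.sub_apply, Pi.smul_apply, smul_eq_mul, Pi.zero_apply] at this
    linarith
  have hneg : ({i ∈ S | z i < 0} : Finset ι).Nonempty := by
    by_contra h
    rw [not_nonempty_iff_eq_empty, filter_eq_empty_iff] at h
    have : z = 0 := hker z (fun i => by
      by_cases hi : i ∈ S
      · exact not_lt.1 (h hi)
      · exact (hzS i hi).ge) hz
    simp [this] at hzs
  obtain ⟨k, hk, hkmin⟩ := exists_min_image _ (fun i => x i / -z i) hneg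
  rw [mem_filter] at hk
  obtain ⟨hkS, hzk⟩ := hk
  have hks : k ≠ s := by
    rintro rfl
    linarith
  obtain ⟨y, hy0, hyk, hy⟩ : Feasible L b (S.erase k) := by
    have ht : 0 ≤ x k / -z k := div_nonneg (hx0 k) (by linarith)
    refine ⟨x + (x k / -z k) • z, fun i => ?_, fun i hi => ?_, by simp [hx, hz]⟩
    · simp only [Pi.zero_apply, Pi.add_apply, Pi.smul_apply, smul_eq_mul]
      rcases le_or_gt 0 (z i) with h | h
      · exact add_nonneg (hx0 i) (mul_nonneg ht h)
      · have hiS : i ∈ S := by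
          by_contra hiS
          exact h.ne (hzS i hiS)
        have := hkmin i (mem_filter.2 ⟨hiS, h⟩)
        rw [le_div_iff₀ (by linarith)] at this
        linarith
    · by_cases hik : i = k
      · subst hik
        simp only [Pi.add_apply, Pi.smul_apply, smul_eq_mul]
        rw [div_neg, neg_mul, div_mul_cancel₀ _ hzk.ne, add_neg_cancel]
      · have hiS : i ∉ S := fun hiS => hi (mem_erase.2 ⟨hik, hiS⟩)
        simp [hzS i hiS, hxs i fun h => hiS (mem_of_mem_erase h)]
  have hyline := hline y hy fun i hi => hyk i fun h => hi (mem_of_mem_erase h)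
  have : ({k ∈ S | Feasible L b (S.erase k)} : Finset ι) = {s, k} := by
    ext j
    simp only [mem_filter, mem_insert, mem_singleton]
    constructor
    · rintro ⟨hjS, w, hw0, hwj, hw⟩
      by_contra! hj
      obtain ⟨hjs, hjk⟩ := hj
      have hwline := hline w hw fun i hi => hwj i fun h => hi (mem_of_mem_erase h)
      have hyj : 0 < y j :=
        (hy0 j).lt_of_ne' (hne k hkS y hy hyk j (mem_erase.2 ⟨hjk, hjS⟩))
      have hwk : 0 < w k :=
        (hw0 k).lt_of_ne' (hne j hjS w hw hwj k (mem_erase.2 ⟨hjk.symm, hkS⟩))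
      have hxj : 0 < x j :=
        (hx0 j).lt_of_ne' (hne s hsS x hx hxs j (mem_erase.2 ⟨hjs, hjS⟩))
      have hwj0 : w j = 0 := hwj j (by simp)
      have hyk0 : y k = 0 := hyk k (by simp)
      have hws : 0 ≤ w s := hw0 s
      rw [hwline] at hwk hwj0
      rw [hyline] at hyj hyk0
      have hlt : w s < y s := by nlinarith
      have hzj : z j < 0 := by nlinarith
      nlinarith
    · rintro (rfl | rfl)
      · exact ⟨hsS, x, hx0, hxs, hx⟩
      · exact ⟨hkS, y, hy0, hyk, hy⟩
  rw [this, card_pair hks.symm]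
  exact even_two

/-- Nondegenerate right-hand sides are dense. -/
theorem exists_nondegenerate_mem_ball (L : (ι → ℝ) →ₗ[ℝ] R → ℝ) (b₀ : R → ℝ) {ε : ℝ}
    (hε : 0 < ε) :
    ∃ b ∈ Metric.ball b₀ ε, ∀ x, L x = b → Fintype.card R ≤ #{i | x i ≠ 0} := by
  classical
  let P : Finset ι → Submodule ℝ (R → ℝ) := fun T =>
    Submodule.span ℝ (T.image fun i => L (Pi.single i 1) : Finset (R → ℝ))
  have hP : ∀ T, #T < Fintype.card R → P T ≠ ⊤ := fun T hT h => by
    have h1 : Module.finrank ℝ (P T) ≤ #T :=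
      (finrank_span_finset_le_card _).trans card_image_le
    rw [h, finrank_top, Module.finrank_fintype_fun_eq_card] at h1
    omega
  have hnull : MeasureTheory.volume
      (⋃ T ∈ {T : Finset ι | #T < Fintype.card R}, (P T : Set (R → ℝ))) = 0 := by
    rw [MeasureTheory.measure_biUnion_null_iff (Set.to_countable _)]
    exact fun T hT => MeasureTheory.Measure.addHaar_submodule _ _ (hP T hT)
  have hball := Metric.measure_ball_pos MeasureTheory.volume b₀ hε
  obtain ⟨b, hb, hbP⟩ : ∃ b ∈ Metric.ball b₀ ε,
      b ∉ ⋃ T ∈ {T : Finset ι | #T < Fintype.card R}, (P T : Set (R → ℝ)) := by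
    by_contra! h
    exact hball.ne' (MeasureTheory.measure_mono_null h hnull)
  refine ⟨b, hb, fun x hx => ?_⟩
  by_contra! hlt
  refine hbP (Set.mem_biUnion hlt ?_)
  rw [← hx, LinearMap.pi_apply_eq_sum_univ L x, SetLike.mem_coe]
  refine Submodule.sum_mem _ fun i _ => ?_
  by_cases hi : x i = 0
  · simp [hi]
  · refine Submodule.smul_mem _ _ (Submodule.subset_span ?_)
    rw [mem_coe, mem_image]
    refine ⟨i, by simpa using hi, ?_⟩
    congr 1
    ext j
    simp [Pi.single_apply, eq_comm]

end Feasible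

section ScarfLemma

variable {R N α : Type*} [Fintype N]

/-- The linear map with matrix `[1 | B]`. -/
def slackMap (B : R → N → ℝ) : (R ⊕ N → ℝ) →ₗ[ℝ] R → ℝ where
  toFun x v := x (Sum.inl v) + ∑ e, B v e * x (Sum.inr e)
  map_add' x y := by
    ext v
    simp only [Pi.add_apply, mul_add, sum_add_distrib]
    ring
  map_smul' t x := by
    ext v
    simp only [Pi.smul_apply, smul_eq_mul, RingHom.id_apply, mul_add, mul_sum]
    congr 1
    exact sum_congr rfl fun e _ => by ring

theorem slackMap_apply (B : R → N → ℝ) (x : R ⊕ N → ℝ) (v : R) :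
    slackMap B x v = x (Sum.inl v) + ∑ e, B v e * x (Sum.inr e) := rfl

theorem inl_le_slackMap {B : R → N → ℝ} (hB : ∀ v e, 0 ≤ B v e) {x : R ⊕ N → ℝ} (hx : 0 ≤ x)
    (v : R) : x (Sum.inl v) ≤ slackMap B x v :=
  le_add_of_nonneg_right (sum_nonneg fun e _ => mul_nonneg (hB v e) (hx _))

theorem mul_inr_le_slackMap {B : R → N → ℝ} (hB : ∀ v e, 0 ≤ B v e) {x : R ⊕ N → ℝ}
    (hx : 0 ≤ x) (v : R) (e : N) : B v e * x (Sum.inr e) ≤ slackMap B x v :=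
  (single_le_sum (f := fun e => B v e * x (Sum.inr e))
    (fun e _ => mul_nonneg (hB v e) (hx _)) (mem_univ e)).trans
    (le_add_of_nonneg_left (hx _))

variable [Fintype R] [DecidableEq R] [DecidableEq N] [Nonempty N] [LinearOrder α]

/-- **Scarf's lemma** for a nondegenerate right-hand side. -/
theorem exists_dominating_feasible_of_nondegenerate {B : R → N → ℝ} (hB : ∀ v e, 0 ≤ B v e)
    (hpos : ∀ e, ∃ v, 0 < B v e) {b : R → ℝ} (hb : 0 ≤ b)
    (hgen : ∀ x, slackMap B x = b → Fintype.card R ≤ #{i | x i ≠ 0})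
    {c : R → R ⊕ N → α} (hc : ∀ v, Function.Injective (c v))
    (hmin : ∀ v e, c v (Sum.inl v) < c v (Sum.inr e))
    (hmax : ∀ v u e, u ≠ v → c v (Sum.inr e) < c v (Sum.inl u)) :
    ∃ J, Dominating c J ∧ Feasible (slackMap B) b J := by
  classical
  have hker : ∀ z, 0 ≤ z → slackMap B z = 0 → z = 0 := by
    intro z hz h
    ext (v | e)
    · have := inl_le_slackMap hB hz v
      rw [h] at this
      exact le_antisymm this (hz _)
    · obtain ⟨v, hv⟩ := hpos e
      have := mul_inr_le_slackMap hB hz v e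
      rw [h] at this
      exact le_antisymm (nonpos_of_mul_nonpos_right this hv) (hz _)
  let D : Finset (Finset (R ⊕ N)) :=
    {J | #J = Fintype.card R ∧ (Dominating c J ∨ J = slackSet R N)}
  let F : Finset (Finset (R ⊕ N)) := {J | #J = Fintype.card R ∧ Feasible (slackMap B) b J}
  have hslack : #(slackSet R N) = Fintype.card R := by
    rw [slackSet, card_image_of_injective _ Sum.inl_injective, card_univ]
  have heven : Even #(D ∩ F) := by
    refine even_card_inter_of_cycle_of_cocycle (n := Fintype.card R)
      (Sum.inr (Classical.arbitrary N)) (fun J hJ => (mem_filter.1 hJ).2.1)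
      (fun J hJ => (mem_filter.1 hJ).2.1) (fun K hK => ?_) (fun S hS => ?_)
    · convert even_card_insert_dominating_or_slackSet hc hmin hmax hK using 3 with j
      refine and_congr_right fun hj => ?_
      simp [D, card_insert_of_notMem hj, hK]
    · convert even_card_feasible_erase hker hgen hS using 2
      refine filter_congr fun k hk => ?_
      simp [F, card_erase_of_mem hk, hS]
  have hmem : slackSet R N ∈ D ∩ F := by
    simp only [D, F, mem_inter, mem_filter, mem_univ, true_and, hslack, or_true]
    refine ⟨Sum.elim b 0, ?_, ?_, ?_⟩
    · rintro (v | e)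
      · exact hb v
      · exact le_rfl
    · rintro (v | e) h
      · exact absurd (mem_image_of_mem _ (mem_univ v)) h
      · rfl
    · ext v
      simp [slackMap_apply]
  obtain ⟨J, hJ, hne⟩ : ∃ J ∈ D ∩ F, J ≠ slackSet R N := by
    refine exists_mem_ne ?_ _
    have := card_pos.2 ⟨_, hmem⟩
    rw [Nat.even_iff] at heven
    omega
  simp only [D, F, mem_inter, mem_filter, mem_univ, true_and] at hJ
  exact ⟨J, hJ.1.2.resolve_right hne, hJ.2.2⟩

/-- **Scarf's lemma**. -/
theorem exists_dominating_feasible {B : R → N → ℝ} (hB : ∀ v e, 0 ≤ B v e)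
    (hpos : ∀ e, ∃ v, 0 < B v e) {b : R → ℝ} (hb : ∀ v, 0 < b v)
    {c : R → R ⊕ N → α} (hc : ∀ v, Function.Injective (c v))
    (hmin : ∀ v e, c v (Sum.inl v) < c v (Sum.inr e))
    (hmax : ∀ v u e, u ≠ v → c v (Sum.inr e) < c v (Sum.inl u)) :
    ∃ J, Dominating c J ∧ Feasible (slackMap B) b J := by
  choose r hr using hpos
  let M : R ⊕ N → ℝ := Sum.elim (fun v => b v + 1) fun e => (b (r e) + 1) / B (r e) e
  let C : Set (R ⊕ N → ℝ) :=
    ⋃ J ∈ {J | Dominating c J}, Set.Icc 0 M ∩ {x | ∀ i ∉ J, x i = 0}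
  have hC : IsCompact C := by
    refine (Set.toFinite _).isCompact_biUnion fun J _ => isCompact_Icc.inter_right ?_
    simp only [Set.ofPred_forall]
    exact isClosed_iInter fun i => isClosed_iInter fun _ =>
      isClosed_eq (continuous_apply i) continuous_const
  have hclosed : IsClosed (slackMap B '' C) :=
    (hC.image (slackMap B).continuous_of_finiteDimensional).isClosed
  obtain ⟨δ, hδ, hδb⟩ : ∃ δ > 0, ∀ v, δ ≤ b v := by
    cases isEmpty_or_nonempty R
    · exact ⟨1, one_pos, fun v => isEmptyElim v⟩
    · obtain ⟨v, hv⟩ := Finite.exists_min b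
      exact ⟨b v, hb v, hv⟩
  have hmem : b ∈ slackMap B '' C := by
    rw [← hclosed.closure_eq, Metric.mem_closure_iff]
    intro ε hε
    obtain ⟨b', hb', hgen⟩ := exists_nondegenerate_mem_ball (slackMap B) b
      (lt_min hε (lt_min hδ one_pos))
    rw [Metric.mem_ball, lt_min_iff, lt_min_iff] at hb'
    obtain ⟨hbε, hbδ, hb1⟩ := hb'
    have hcoord : ∀ v, |b' v - b v| ≤ dist b' b := fun v => by
      rw [← Real.dist_eq]
      exact dist_le_pi_dist b' b v
    have hlow : ∀ v, 0 ≤ b' v := fun v => by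
      have := (abs_le.1 (hcoord v)).1
      linarith [hδb v]
    have hup : ∀ v, b' v ≤ b v + 1 := fun v => by
      have := (abs_le.1 (hcoord v)).2
      linarith
    obtain ⟨J, hJ, x, hx0, hxJ, hx⟩ := exists_dominating_feasible_of_nondegenerate hB
      (fun e => ⟨r e, hr e⟩) hlow hgen hc hmin hmax
    refine ⟨b', ⟨x, Set.mem_biUnion hJ ⟨⟨hx0, ?_⟩, hxJ⟩, hx⟩, by rwa [dist_comm]⟩
    rintro (v | e)
    · have := inl_le_slackMap hB hx0 v
      rw [hx] at this
      exact this.trans (hup v)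
    · have := mul_inr_le_slackMap hB hx0 (r e) e
      rw [hx] at this
      change _ ≤ (b (r e) + 1) / B (r e) e
      rw [le_div_iff₀ (hr e), mul_comm]
      exact this.trans (hup _)
  obtain ⟨x, hxC, hx⟩ := hmem
  simp only [C, Set.mem_iUnion] at hxC
  obtain ⟨J, hJ, hxM, hxJ⟩ := hxC
  exact ⟨J, hJ, x, hxM.1, hxJ, hx⟩

end ScarfLemma

end Scarf

namespace HypergraphicPreference

open Finset

variable {V : Type*} [Fintype V] [DecidableEq V]

open Classical in
/-- The utilities to which Scarf's lemma is applied. Row `v` ranks, from worst to best: its own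
slack column, the edges containing `v` in the order `le v`, the other edges, the other slack
columns. -/
noncomputable def utility (E : Finset (Finset V)) (le : V → Finset V → Finset V → Prop) (v : V) :
    V ⊕ E → ℕ ×ₗ ℕ
  | .inl u => if u = v then toLex (0, 0) else toLex (3, Fintype.equivFin V u)
  | .inr e => if v ∈ e.1 then toLex (1, #{f ∈ E | v ∈ f ∧ le v f e})
      else toLex (2, Fintype.equivFin E e)

variable {E : Finset (Finset V)} {le : V → Finset V → Finset V → Prop}

theorem utility_inl_lt (v : V) (e : E) : utility E le v (.inl v) < utility E le v (.inr e) := by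
  simp only [utility]
  split_ifs <;> simp [Prod.Lex.toLex_lt_toLex]

theorem utility_lt_inl (v u : V) (e : E) (h : u ≠ v) :
    utility E le v (.inr e) < utility E le v (.inl u) := by
  simp only [utility, if_neg h]
  split_ifs <;> simp [Prod.Lex.toLex_lt_toLex]

theorem mem_of_utility_le {v : V} {e f : E} (hf : v ∈ f.1)
    (h : utility E le v (.inr e) ≤ utility E le v (.inr f)) : v ∈ e.1 := by
  by_contra he
  simp [utility, he, hf, Prod.Lex.toLex_le_toLex] at h

theorem le_of_utility_le (hrefl : ∀ v, ∀ e ∈ E, v ∈ e → le v e e)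
    (htrans : ∀ v, ∀ e ∈ E, ∀ f ∈ E, ∀ g ∈ E, v ∈ e → v ∈ f → v ∈ g →
      le v e f → le v f g → le v e g)
    (htotal : ∀ v, ∀ e ∈ E, ∀ f ∈ E, v ∈ e → v ∈ f → le v e f ∨ le v f e)
    {v : V} {e f : E} (he : v ∈ e.1) (hf : v ∈ f.1)
    (h : utility E le v (.inr e) ≤ utility E le v (.inr f)) : le v e f := by
  classical
  refine (htotal v e e.2 f f.2 he hf).elim id fun hfe => ?_
  simp only [utility, if_pos he, if_pos hf, Prod.Lex.toLex_le_toLex, lt_irrefl, true_and,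
    false_or] at h
  have hsub : ({g ∈ E | v ∈ g ∧ le v g f} : Finset (Finset V)) ⊆ {g ∈ E | v ∈ g ∧ le v g e} :=
    fun g hg => by
      obtain ⟨hgE, hvg, hgf⟩ := mem_filter.1 hg
      exact mem_filter.2 ⟨hgE, hvg, htrans v g hgE f f.2 e e.2 hvg hf he hgf hfe⟩
  have hmem : e.1 ∈ ({g ∈ E | v ∈ g ∧ le v g f} : Finset (Finset V)) := by
    rw [eq_of_subset_of_card_le hsub (by convert h)]
    exact mem_filter.2 ⟨e.2, he, hrefl v e e.2 he⟩
  exact (mem_filter.1 hmem).2.2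

theorem utility_injective (hrefl : ∀ v, ∀ e ∈ E, v ∈ e → le v e e)
    (hantisymm : ∀ v, ∀ e ∈ E, ∀ f ∈ E, v ∈ e → v ∈ f → le v e f → le v f e → e = f)
    (htrans : ∀ v, ∀ e ∈ E, ∀ f ∈ E, ∀ g ∈ E, v ∈ e → v ∈ f → v ∈ g →
      le v e f → le v f g → le v e g)
    (htotal : ∀ v, ∀ e ∈ E, ∀ f ∈ E, v ∈ e → v ∈ f → le v e f ∨ le v f e) (v : V) :
    Function.Injective (utility E le v) := by
  have hne : ∀ u (e : E), utility E le v (.inl u) ≠ utility E le v (.inr e) := fun u e => by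
    by_cases h : u = v
    · rw [h]
      exact (utility_inl_lt v e).ne
    · exact (utility_lt_inl v u e h).ne'
  rintro (u | e) (u' | f) h
  · simp only [utility] at h
    split_ifs at h with h₁ h₂ h₂
    · rw [h₁, h₂]
    · simp at h
    · simp at h
    · simpa [Fin.val_inj] using h
  · exact absurd h (hne u f)
  · exact absurd h.symm (hne u' e)
  · by_cases he : v ∈ e.1
    · have hf : v ∈ f.1 := mem_of_utility_le he h.ge
      exact congrArg _ (Subtype.ext (hantisymm v e e.2 f f.2 he hf
        (le_of_utility_le hrefl htrans htotal he hf h.le)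
        (le_of_utility_le hrefl htrans htotal hf he h.ge)))
    · have hf : v ∉ f.1 := fun hf => he (mem_of_utility_le hf h.le)
      simpa [utility, he, hf, Fin.val_inj] using h

end HypergraphicPreference


open Classical in
/-- **Aharoni–Fleiner.**  Every finite hypergraphic preference system has a fractional
stable matching.  Here the hypergraph has vertex set `V` and (nonempty) edge set `E`,
and for each vertex `v` the relation `le v` is a linear order on the set `D(v)` of edges
containing `v`.  A fractional matching is a non-negative `w` on the edges with
`∑_{h ∋ v} w h ≤ 1` for every `v`; it is stable if every edge `e` contains a vertex `v`
with `∑_{h ∋ v, e ≤_v h} w h = 1`. -/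
theorem hypergraphic_fractional_stable_matching {V : Type} [Fintype V] [DecidableEq V]
    (E : Finset (Finset V)) (hE : ∀ e ∈ E, e.Nonempty)
    (le : V → Finset V → Finset V → Prop)
    (hrefl : ∀ v, ∀ e ∈ E, v ∈ e → le v e e)
    (hantisymm : ∀ v, ∀ e ∈ E, ∀ f ∈ E, v ∈ e → v ∈ f → le v e f → le v f e → e = f)
    (htrans : ∀ v, ∀ e ∈ E, ∀ f ∈ E, ∀ g ∈ E, v ∈ e → v ∈ f → v ∈ g →
      le v e f → le v f g → le v e g)
    (htotal : ∀ v, ∀ e ∈ E, ∀ f ∈ E, v ∈ e → v ∈ f → le v e f ∨ le v f e) :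
    ∃ w : Finset V → ℝ, (∀ e, 0 ≤ w e) ∧
      (∀ v : V, ∑ h ∈ E.filter (fun h => v ∈ h), w h ≤ 1) ∧
      (∀ e ∈ E, ∃ v ∈ e, ∑ h ∈ E.filter (fun h => v ∈ h ∧ le v e h), w h = 1) := by
  rcases E.eq_empty_or_nonempty with rfl | hEne
  · exact ⟨0, by simp, by simp, by simp⟩
  have : Nonempty E := hEne.to_subtype
  obtain ⟨J, hJ, x, hx0, hxJ, hx⟩ := Scarf.exists_dominating_feasible
    (B := fun (v : V) (e : E) => if v ∈ e.1 then (1 : ℝ) else 0) (b := 1)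
    (fun v e => by split_ifs <;> norm_num)
    (fun e => (hE e e.2).imp fun v hv => by simp [hv]) (fun _ => one_pos)
    (HypergraphicPreference.utility_injective hrefl hantisymm htrans htotal)
    HypergraphicPreference.utility_inl_lt HypergraphicPreference.utility_lt_inl
  let w : Finset V → ℝ := fun h => if hh : h ∈ E then x (.inr ⟨h, hh⟩) else 0
  have hw0 : ∀ h, 0 ≤ w h := fun h => by
    simp only [w]
    split_ifs
    · exact hx0 _
    · exact le_rfl
  have hwJ : ∀ h (hh : h ∈ E), w h ≠ 0 → Sum.inr ⟨h, hh⟩ ∈ J := fun h hh hne => by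
    by_contra hJ
    exact hne (by simp [w, hh, hxJ _ hJ])
  have hrow : ∀ v, x (.inl v) + ∑ h ∈ E.filter (fun h => v ∈ h), w h = 1 := fun v => by
    have := congrFun hx v
    rw [Scarf.slackMap_apply, Pi.one_apply] at this
    rw [← this, Finset.sum_filter, ← Finset.sum_coe_sort]
    simp [w]
  refine ⟨w, hw0, fun v => hrow v ▸ le_add_of_nonneg_left (hx0 _), fun e he => ?_⟩
  obtain ⟨v, hv⟩ := hJ (.inr ⟨e, he⟩)
  have hslack : x (.inl v) = 0 := hxJ _ fun h =>
    (HypergraphicPreference.utility_inl_lt v _).not_ge (hv _ h)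
  have hsum := hrow v
  rw [hslack, zero_add] at hsum
  have hve : v ∈ e := by
    obtain ⟨h, hh, hne⟩ := Finset.exists_ne_zero_of_sum_ne_zero (hsum.trans_ne one_ne_zero)
    obtain ⟨hhE, hvh⟩ := Finset.mem_filter.1 hh
    exact HypergraphicPreference.mem_of_utility_le hvh (hv _ (hwJ h hhE hne))
  refine ⟨v, hve, ?_⟩
  rw [← hsum]
  refine Finset.sum_subset (Finset.monotone_filter_right _ fun h _ hh => hh.1)
    fun h hh hnot => ?_
  obtain ⟨hhE, hvh⟩ := Finset.mem_filter.1 hh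
  by_contra hne
  exact hnot (Finset.mem_filter.2 ⟨hhE, hvh, HypergraphicPreference.le_of_utility_le
    (e := ⟨e, he⟩) (f := ⟨h, hhE⟩) hrefl htrans htotal hve hvh (hv _ (hwJ h hhE hne))⟩)
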